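/- Let E, r, σ > 0 and let ϱ^{SSC} and ϱ^{Zhu} denote the Stamicar–Ševčovič–Chadam and Zhu approximations of the early exercise boundary. Then lim_{τ→0⁺} [(E - ϱ^{SSC}(τ)) / (E - ϱ^{Zhu}(τ))]·√(-ln τ) = √(2π); in particular, lim_{τ→0⁺} (E - ϱ^{SSC}(τ)) / (E - ϱ^{Zhu}(τ)) = 0, so close to expiry Zhu's formula undershoots the early exercise boundary relative to ϱ^{SSC}. -/

import Mathlib

open MeasureTheory Real Filter Topology Set

/-- `log (z / γ) / (z - γ)`, with its removable singularity at `z = γ` filled in. -/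
noncomputable def logQuot (γ : ℝ) : ℂ → ℂ :=
  dslope (fun w : ℂ => Complex.log (w / γ)) γ

/-- The holomorphic function `exp (-log (z / γ) / (z - γ))`; on the line `re z = a` its imaginary
part is the oscillating factor `exp (-f₁) * sin f₂` in Zhu's formula. -/
noncomputable def zhuKernel (γ : ℝ) (z : ℂ) : ℂ :=
  Complex.exp (-logQuot γ z)

lemma isOpen_re_pos : IsOpen {z : ℂ | 0 < z.re} :=
  isOpen_lt continuous_const Complex.continuous_re

lemma div_mem_slitPlane {γ : ℝ} (hγ : 0 < γ) {z : ℂ} (hz : 0 < z.re) :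
    z / γ ∈ Complex.slitPlane := by
  left
  rw [Complex.div_ofReal_re]
  positivity

lemma sub_mul_logQuot {γ : ℝ} (hγ : 0 < γ) (z : ℂ) :
    (z - γ) * logQuot γ z = Complex.log (z / γ) := by
  have h := sub_smul_dslope (fun w : ℂ => Complex.log (w / γ)) (γ : ℂ) z
  have h1 : (γ : ℂ) ≠ 0 := by exact_mod_cast hγ.ne'
  simpa [logQuot, div_self h1] using h

lemma logQuot_eq_div {γ : ℝ} (hγ : 0 < γ) {z : ℂ} (hz : z ≠ γ) :
    logQuot γ z = Complex.log (z / γ) / (z - γ) := by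
  rw [eq_div_iff (sub_ne_zero.2 hz), mul_comm, sub_mul_logQuot hγ]

lemma differentiableOn_logQuot {γ : ℝ} (hγ : 0 < γ) :
    DifferentiableOn ℂ (logQuot γ) {z : ℂ | 0 < z.re} := by
  refine (Complex.differentiableOn_dslope (isOpen_re_pos.mem_nhds (by simpa using hγ))).2 ?_
  intro z hz
  exact ((differentiableAt_id.div_const (γ : ℂ)).clog
    (div_mem_slitPlane (z := z) hγ hz)).differentiableWithinAt

lemma differentiableOn_zhuKernel {γ : ℝ} (hγ : 0 < γ) :
    DifferentiableOn ℂ (zhuKernel γ) {z : ℂ | 0 < z.re} :=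
  (differentiableOn_logQuot hγ).neg.cexp

lemma zhuKernel_one_add {γ : ℝ} (hγ : 0 < γ) :
    zhuKernel γ (1 + γ) = γ / (1 + γ) := by
  have h := sub_mul_logQuot hγ (1 + γ : ℂ)
  have h0 : (γ : ℂ) ≠ 0 := by exact_mod_cast hγ.ne'
  have h1 : (1 + γ : ℂ) ≠ 0 := by
    exact_mod_cast (by positivity : (1 + γ : ℝ) ≠ 0)
  rw [add_sub_cancel_right, one_mul] at h
  rw [zhuKernel, h, Complex.exp_neg, Complex.exp_log (div_ne_zero h1 h0), inv_div]

lemma zhuKernel_conj {γ : ℝ} (hγ : 0 < γ) {z : ℂ} (hz : 0 < z.re) (hz' : z.im ≠ 0) :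
    zhuKernel γ (starRingEnd ℂ z) = starRingEnd ℂ (zhuKernel γ z) := by
  have h1 : z ≠ γ := fun h => hz' (by simp [h])
  have h2 : starRingEnd ℂ z ≠ γ := fun h => hz' (by simpa using congrArg Complex.im h)
  have h3 : starRingEnd ℂ z / γ = starRingEnd ℂ (z / γ) := by simp
  rw [zhuKernel, zhuKernel, logQuot_eq_div hγ h1, logQuot_eq_div hγ h2, h3,
    Complex.log_conj _ (Complex.slitPlane_arg_ne_pi (div_mem_slitPlane hγ hz)),
    ← Complex.exp_conj]
  simp

lemma zhuKernel_im {γ a b ζ : ℝ} (hγ : 0 < γ) (ha : 0 < a) (hb : b = a - γ) (hζ : 0 < ζ) :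
    (zhuKernel γ (a + ζ * Complex.I)).im =
      Real.exp (-((b * Real.log ((1 / γ) * Real.sqrt (a ^ 2 + ζ ^ 2))
        + ζ * Real.arctan (ζ / a)) / (b ^ 2 + ζ ^ 2))) *
      Real.sin ((ζ * Real.log ((1 / γ) * Real.sqrt (a ^ 2 + ζ ^ 2))
        - b * Real.arctan (ζ / a)) / (b ^ 2 + ζ ^ 2)) := by
  set z : ℂ := a + ζ * Complex.I with hz
  have hre : z.re = a := by simp [hz]
  have him : z.im = ζ := by simp [hz]
  have hzγ : z ≠ γ := fun h => hζ.ne' (by rw [← him, h]; simp)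
  have hnorm : ‖z / γ‖ = (1 / γ) * Real.sqrt (a ^ 2 + ζ ^ 2) := by
    rw [norm_div, hz, Complex.norm_add_mul_I, Complex.norm_real, Real.norm_of_nonneg hγ.le]
    ring
  have harg : (z / γ).arg = Real.arctan (ζ / a) := by
    have : z / γ = ((1 / γ : ℝ) : ℂ) * z := by push_cast; ring
    rw [this, Complex.arg_real_mul _ (by positivity),
      ← Real.arctan_tan (x := z.arg), Complex.tan_arg, hre, him]
    · exact Complex.neg_pi_div_two_lt_arg_iff.2 (Or.inl (by rw [hre]; exact ha))
    · exact Complex.arg_lt_pi_div_two_iff.2 (Or.inl (by rw [hre]; exact ha))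
  have hD : b ^ 2 + ζ ^ 2 ≠ 0 := by positivity
  have hDC : (b : ℂ) ^ 2 + (ζ : ℂ) ^ 2 ≠ 0 := by exact_mod_cast hD
  have hq : z - γ = b + ζ * Complex.I := by rw [hz, hb]; push_cast; ring
  have hlog : Complex.log (z / γ) = (Real.log ((1 / γ) * Real.sqrt (a ^ 2 + ζ ^ 2)) : ℝ)
      + (Real.arctan (ζ / a) : ℝ) * Complex.I := by
    rw [← hnorm, ← harg, Complex.log]
  set L := Real.log ((1 / γ) * Real.sqrt (a ^ 2 + ζ ^ 2))
  set θ := Real.arctan (ζ / a)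
  have hmain : -logQuot γ z = ((-((b * L + ζ * θ) / (b ^ 2 + ζ ^ 2)) : ℝ) : ℂ)
      + (((ζ * L - b * θ) / (b ^ 2 + ζ ^ 2) : ℝ) : ℂ) * Complex.I := by
    rw [logQuot_eq_div hγ hzγ, hlog, ← neg_div, div_eq_iff (sub_ne_zero.2 hzγ), hq]
    push_cast
    field_simp
    ring_nf
    simp only [Complex.I_sq]
    ring
  rw [zhuKernel, hmain, Complex.exp_im]
  simp only [Complex.add_re, Complex.add_im, Complex.re_ofReal_mul, Complex.im_ofReal_mul,
    Complex.ofReal_re, Complex.ofReal_im, Complex.I_re, Complex.I_im, mul_zero, mul_one,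
    add_zero, zero_add]

lemma exists_logQuot_bound {γ a : ℝ} (hγ : 0 < γ) (ha : 0 < a) :
    ∃ C : ℝ, 0 < C ∧ ∀ z : ℂ, a ≤ z.re →
      ‖logQuot γ z‖ * ‖z‖ ≤ C * (1 + Real.log (1 + ‖z‖)) := by
  have hK : IsCompact ({z : ℂ | a ≤ z.re} ∩ Metric.closedBall 0 (2 * γ)) :=
    (isCompact_closedBall _ _).inter_left (isClosed_le continuous_const Complex.continuous_re)
  obtain ⟨M, hM⟩ := hK.exists_bound_of_continuousOn
    ((differentiableOn_logQuot hγ).continuousOn.mono fun z hz => lt_of_lt_of_le ha hz.1)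
  have hπ := Real.pi_pos
  refine ⟨2 * γ * |M| + 2 * (1 + |Real.log γ| + π), by positivity, fun z hz => ?_⟩
  have hl : 0 ≤ Real.log (1 + ‖z‖) := Real.log_nonneg (by linarith [norm_nonneg z])
  have hz0 : 0 < ‖z‖ := norm_pos_iff.2 (fun h => by simp [h] at hz; linarith)
  have hX : 0 ≤ |Real.log γ| := abs_nonneg _
  rcases le_or_gt ‖z‖ (2 * γ) with h | h
  · have h1 : ‖logQuot γ z‖ ≤ |M| := (hM z ⟨hz, by simpa using h⟩).trans (le_abs_self M)
    have h2 : ‖logQuot γ z‖ * ‖z‖ ≤ |M| * (2 * γ) := by gcongr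
    have h3 : 0 ≤ 2 * γ * |M| * Real.log (1 + ‖z‖) := by positivity
    have h4 : 0 ≤ 2 * (1 + |Real.log γ| + π) * (1 + Real.log (1 + ‖z‖)) := by positivity
    nlinarith
  · have h1 : ‖z‖ ≤ 2 * ‖z - γ‖ := by
      have := norm_sub_norm_le z (γ : ℂ)
      rw [Complex.norm_real, Real.norm_of_nonneg hγ.le] at this
      linarith
    have h2 : ‖logQuot γ z‖ * ‖z‖ ≤ 2 * ‖Complex.log (z / γ)‖ := by
      rw [← sub_mul_logQuot hγ, norm_mul]
      nlinarith [norm_nonneg (logQuot γ z)]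
    have h3 : ‖Complex.log (z / γ)‖ ≤ |Real.log ‖z / γ‖| + π := by
      refine (Complex.norm_le_abs_re_add_abs_im _).trans ?_
      rw [Complex.log_re, Complex.log_im]
      gcongr
      exact Complex.abs_arg_le_pi _
    have h4 : |Real.log ‖z / γ‖| ≤ Real.log (1 + ‖z‖) + |Real.log γ| := by
      have h5 : ‖z / γ‖ = ‖z‖ / γ := by
        rw [norm_div, Complex.norm_real, Real.norm_of_nonneg hγ.le]
      rw [h5, abs_of_nonneg (Real.log_nonneg (by rw [le_div_iff₀ hγ]; linarith)),
        Real.log_div hz0.ne' hγ.ne']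
      have h6 : Real.log ‖z‖ ≤ Real.log (1 + ‖z‖) := Real.log_le_log hz0 (by linarith)
      linarith [neg_abs_le (Real.log γ)]
    have h7 : 0 ≤ 2 * γ * |M| * (1 + Real.log (1 + ‖z‖)) := by positivity
    have h8 : 0 ≤ (|Real.log γ| + π) * Real.log (1 + ‖z‖) := by positivity
    nlinarith

lemma exists_zhuKernel_bound {γ a : ℝ} (hγ : 0 < γ) (ha : 0 < a) :
    ∃ C : ℝ, 0 < C ∧ ∀ z : ℂ, a ≤ z.re →
      ‖zhuKernel γ z - 1‖ ≤ C * (1 + Real.log (1 + ‖z‖)) / ‖z‖ := by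
  obtain ⟨C, hC, h⟩ := exists_logQuot_bound hγ ha
  refine ⟨C * Real.exp (C * (1 + 1 / a)), by positivity, fun z hz => ?_⟩
  have haz : a ≤ ‖z‖ := hz.trans (Complex.re_le_norm z)
  have hz0 : 0 < ‖z‖ := ha.trans_le haz
  have h1 : ‖logQuot γ z‖ ≤ C * (1 + Real.log (1 + ‖z‖)) / ‖z‖ :=
    (le_div_iff₀ hz0).2 (h z hz)
  have h2 : ‖logQuot γ z‖ ≤ C * (1 + 1 / a) := by
    refine h1.trans ?_
    rw [div_le_iff₀ hz0, mul_assoc]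
    gcongr
    have h3 : Real.log (1 + ‖z‖) ≤ ‖z‖ := by
      have := Real.log_le_sub_one_of_pos (by positivity : 0 < 1 + ‖z‖)
      linarith
    have h4 : 1 ≤ 1 / a * ‖z‖ := by
      rw [div_mul_eq_mul_div, one_mul, le_div_iff₀ ha]; linarith
    linarith
  have h5 := Complex.norm_exp_sub_sum_le_norm_mul_exp (-logQuot γ z) 1
  simp only [Finset.range_one, Finset.sum_singleton, pow_zero, Nat.factorial_zero, Nat.cast_one,
    div_one, pow_one, norm_neg] at h5
  calc ‖zhuKernel γ z - 1‖ ≤ ‖logQuot γ z‖ * Real.exp ‖logQuot γ z‖ := h5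
    _ ≤ (C * (1 + Real.log (1 + ‖z‖)) / ‖z‖) * Real.exp (C * (1 + 1 / a)) := by
      have := Real.exp_le_exp.2 h2
      have h6 : 0 ≤ C * (1 + Real.log (1 + ‖z‖)) / ‖z‖ := (norm_nonneg _).trans h1
      gcongr
    _ = _ := by ring

lemma tendsto_zhuKernel_im {γ a : ℝ} (hγ : 0 < γ) :
    Tendsto (fun ζ : ℝ => (zhuKernel γ (a + ζ * Complex.I)).im * ζ / Real.log ζ)
      atTop (𝓝 1) := by
  have hinv : Tendsto (fun ζ : ℝ => ((ζ⁻¹ : ℝ) : ℂ)) atTop (𝓝 0) := by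
    simpa [Function.comp_def] using (Complex.continuous_ofReal.tendsto 0).comp tendsto_inv_atTop_zero
  have hloginv : Tendsto (fun ζ : ℝ => (((Real.log ζ)⁻¹ : ℝ) : ℂ)) atTop (𝓝 0) := by
    simpa [Function.comp_def] using (Complex.continuous_ofReal.tendsto 0).comp
      (tendsto_inv_atTop_zero.comp Real.tendsto_log_atTop)
  have hγ0 : (γ : ℂ) ≠ 0 := by exact_mod_cast hγ.ne'
  have h1 : Tendsto (fun ζ : ℝ => 1 + Complex.log ((a * ((ζ⁻¹ : ℝ) : ℂ) + Complex.I) / γ) *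
      (((Real.log ζ)⁻¹ : ℝ) : ℂ)) atTop (𝓝 1) := by
    have hw : Tendsto (fun ζ : ℝ => (a * ((ζ⁻¹ : ℝ) : ℂ) + Complex.I) / γ) atTop
        (𝓝 (Complex.I / γ)) := by
      simpa using ((hinv.const_mul (a : ℂ)).add_const Complex.I).div_const (γ : ℂ)
    have hs : Complex.I / γ ∈ Complex.slitPlane := by
      right
      rw [Complex.div_ofReal_im, Complex.I_im]
      positivity
    simpa using ((hw.clog hs).mul hloginv).const_add 1
  have h2 : Tendsto (fun ζ : ℝ => (((a - γ : ℝ) : ℂ) * ((ζ⁻¹ : ℝ) : ℂ) + Complex.I)⁻¹) atTop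
      (𝓝 (-Complex.I)) := by
    have := ((hinv.const_mul ((a - γ : ℝ) : ℂ)).add_const Complex.I).inv₀ (by simp)
    simpa using this
  have h3 : Tendsto (fun ζ : ℝ => logQuot γ (a + ζ * Complex.I) * (ζ : ℂ) *
      (((Real.log ζ)⁻¹ : ℝ) : ℂ)) atTop (𝓝 (-Complex.I)) := by
    have h := h1.mul h2
    rw [one_mul] at h
    refine h.congr' ?_
    filter_upwards [eventually_gt_atTop 1] with ζ hζ
    have hζ0 : 0 < ζ := by linarith
    have hζC : (ζ : ℂ) ≠ 0 := by exact_mod_cast hζ0.ne'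
    have hl : (Real.log ζ : ℂ) ≠ 0 := by exact_mod_cast (Real.log_pos hζ).ne'
    have hz : (a + ζ * Complex.I : ℂ) ≠ γ := fun h => hζ0.ne' (by
      simpa using congrArg Complex.im h)
    have hz' : (a + ζ * Complex.I - γ : ℂ) ≠ 0 := sub_ne_zero.2 hz
    have hw0 : (a * ((ζ⁻¹ : ℝ) : ℂ) + Complex.I) / γ ≠ 0 := by
      refine div_ne_zero (fun h => ?_) hγ0
      simpa using congrArg Complex.im h
    have e1 : (a + ζ * Complex.I : ℂ) / γ = ζ * ((a * ((ζ⁻¹ : ℝ) : ℂ) + Complex.I) / γ) := by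
      push_cast; field_simp
    have e2 : ((a - γ : ℝ) : ℂ) * ((ζ⁻¹ : ℝ) : ℂ) + Complex.I
        = (a + ζ * Complex.I - γ) / ζ := by
      push_cast; field_simp; ring
    rw [logQuot_eq_div hγ hz, e1, Complex.log_ofReal_mul hζ0 hw0, e2]
    push_cast
    field_simp
  have h4 : Tendsto (fun ζ : ℝ => ((Real.log ζ / ζ : ℝ) : ℂ)) atTop (𝓝 0) := by
    have : Tendsto (fun ζ : ℝ => Real.log ζ / ζ) atTop (𝓝 0) :=
      Real.isLittleO_log_id_atTop.tendsto_div_nhds_zero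
    simpa [Function.comp_def] using (Complex.continuous_ofReal.tendsto 0).comp this
  have h5 : Tendsto (fun ζ : ℝ => -logQuot γ (a + ζ * Complex.I)) atTop (𝓝 0) := by
    have h := (h3.mul h4).neg
    rw [mul_zero, neg_zero] at h
    refine h.congr' ?_
    filter_upwards [eventually_gt_atTop 1] with ζ hζ
    have hζC : (ζ : ℂ) ≠ 0 := by exact_mod_cast (by linarith : ζ ≠ 0)
    have hl : (Real.log ζ : ℂ) ≠ 0 := by exact_mod_cast (Real.log_pos hζ).ne'
    push_cast
    field_simp
  have h6 : Tendsto (fun ζ : ℝ => dslope Complex.exp 0 (-logQuot γ (a + ζ * Complex.I))) atTop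
      (𝓝 1) := by
    have hc : ContinuousAt (dslope Complex.exp 0) 0 :=
      continuousAt_dslope_same.2 Complex.differentiable_exp.differentiableAt
    simpa [ContinuousAt, dslope_same, Complex.deriv_exp, Function.comp_def] using hc.tendsto.comp h5
  have h7 := (Complex.continuous_im.tendsto _).comp (h3.neg.mul h6)
  rw [neg_neg, mul_one, Complex.I_im] at h7
  refine h7.congr fun ζ => ?_
  have e := sub_smul_dslope Complex.exp 0 (-logQuot γ (a + ζ * Complex.I))
  rw [sub_zero, Complex.exp_zero, smul_eq_mul] at e
  have e' : -(logQuot γ (a + ζ * Complex.I) * (ζ : ℂ) * (((Real.log ζ)⁻¹ : ℝ) : ℂ)) *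
      dslope Complex.exp 0 (-logQuot γ (a + ζ * Complex.I)) =
      (zhuKernel γ (a + ζ * Complex.I) - 1) * ((ζ * (Real.log ζ)⁻¹ : ℝ) : ℂ) := by
    rw [zhuKernel, ← e]
    push_cast
    ring
  rw [Function.comp_apply, e', Complex.im_mul_ofReal]
  simp
  ring

lemma tendsto_integral_vertical {G : ℂ → ℂ} {a C R₀ : ℝ} (ha : 0 < a) (hC : 0 ≤ C)
    (hG : DifferentiableOn ℂ G {z : ℂ | 0 < z.re})
    (hb : ∀ z : ℂ, a ≤ z.re → R₀ ≤ ‖z‖ → ‖G z‖ ≤ C * ‖z‖ ^ (-(3 / 2) : ℝ)) :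
    Tendsto (fun R : ℝ => ∫ t in -R..R, G (a + t * Complex.I)) atTop (𝓝 0) := by
  have hlim : Tendsto (fun R : ℝ => 4 * C * R ^ (-(1 / 2) : ℝ)) atTop (𝓝 0) := by
    simpa using (tendsto_rpow_neg_atTop (by norm_num : (0 : ℝ) < 1 / 2)).const_mul (4 * C)
  refine squeeze_zero_norm' ?_ hlim
  filter_upwards [eventually_ge_atTop R₀, eventually_gt_atTop 0] with R hR hR0
  have hbR : ∀ z : ℂ, a ≤ z.re → R ≤ ‖z‖ → ‖G z‖ ≤ C * R ^ (-(3 / 2) : ℝ) := by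
    intro z hz hRz
    refine (hb z hz (hR.trans hRz)).trans ?_
    exact mul_le_mul_of_nonneg_left
      (Real.rpow_le_rpow_of_nonpos hR0 hRz (by norm_num)) hC
  have hrect := Complex.integral_boundary_rect_eq_zero_of_differentiableOn G
    ⟨a, -R⟩ ⟨a + R, R⟩ (hG.mono (by
      intro z hz
      have h := hz.1
      simp only [Set.mem_preimage] at h
      rw [uIcc_of_le (by linarith)] at h
      exact ha.trans_le h.1))
  simp only [smul_eq_mul] at hrect
  have hbot : ‖∫ x in a..(a + R), G (x + ((-R : ℝ) : ℂ) * Complex.I)‖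
      ≤ C * R ^ (-(3 / 2) : ℝ) * |a + R - a| := by
    refine intervalIntegral.norm_integral_le_of_norm_le_const fun x hx => hbR _ ?_ ?_
    · rw [uIoc_of_le (by linarith)] at hx
      simpa using hx.1.le
    · have := Complex.abs_im_le_norm (x + ((-R : ℝ) : ℂ) * Complex.I)
      simpa [abs_of_pos hR0] using this
  have htop : ‖∫ x in a..(a + R), G (x + (R : ℂ) * Complex.I)‖
      ≤ C * R ^ (-(3 / 2) : ℝ) * |a + R - a| := by
    refine intervalIntegral.norm_integral_le_of_norm_le_const fun x hx => hbR _ ?_ ?_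
    · rw [uIoc_of_le (by linarith)] at hx
      simpa using hx.1.le
    · have := Complex.abs_im_le_norm (x + (R : ℂ) * Complex.I)
      simpa [abs_of_pos hR0] using this
  have hright : ‖∫ y in -R..R, G (((a + R : ℝ) : ℂ) + y * Complex.I)‖
      ≤ C * R ^ (-(3 / 2) : ℝ) * |R - -R| := by
    refine intervalIntegral.norm_integral_le_of_norm_le_const fun y hy => hbR _ ?_ ?_
    · simpa using hR0.le
    · have := Complex.re_le_norm (((a + R : ℝ) : ℂ) + y * Complex.I)
      simp only [Complex.add_re, Complex.ofReal_re, Complex.re_ofReal_mul, Complex.I_re, mul_zero,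
        add_zero] at this
      linarith
  have hpow : R ^ (-(3 / 2) : ℝ) * R = R ^ (-(1 / 2) : ℝ) := by
    rw [← Real.rpow_add_one hR0.ne']
    norm_num
  rw [add_sub_cancel_left, abs_of_pos hR0, mul_assoc, hpow] at hbot htop
  rw [sub_neg_eq_add, ← two_mul, abs_of_pos (by positivity), mul_left_comm, mul_assoc, hpow]
    at hright
  have hleft : Complex.I * ∫ y in -R..R, G (a + y * Complex.I) =
      (∫ x in a..(a + R), G (x + ((-R : ℝ) : ℂ) * Complex.I))
      - (∫ x in a..(a + R), G (x + (R : ℂ) * Complex.I))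
      + Complex.I * ∫ y in -R..R, G (((a + R : ℝ) : ℂ) + y * Complex.I) :=
    (sub_eq_zero.1 hrect).symm
  have hn := congrArg norm hleft
  rw [norm_mul, Complex.norm_I, one_mul] at hn
  rw [hn]
  refine (norm_add_le _ _).trans ?_
  rw [norm_mul, Complex.norm_I, one_mul]
  have := norm_sub_le (∫ x in a..(a + R), G (x + ((-R : ℝ) : ℂ) * Complex.I))
    (∫ x in a..(a + R), G (x + (R : ℂ) * Complex.I))
  linarith

lemma one_add_log_one_add_le {x : ℝ} (hx : 0 ≤ x) :
    1 + Real.log (1 + x) ≤ 2 * √(1 + x) := by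
  have h := Real.log_le_sub_one_of_pos (Real.sqrt_pos.2 (by linarith : 0 < 1 + x))
  rw [Real.log_sqrt (by linarith)] at h
  linarith

lemma exists_zhuKernel_rpow_bound {γ a : ℝ} (hγ : 0 < γ) (ha : 0 < a) :
    ∃ C : ℝ, 0 < C ∧ ∀ z : ℂ, a ≤ z.re →
      ‖zhuKernel γ z - 1‖ ≤ C * ‖z‖ ^ (-(1 / 2) : ℝ) := by
  obtain ⟨C, hC, h⟩ := exists_zhuKernel_bound hγ ha
  refine ⟨C * (2 * √(1 / a + 1)), by positivity, fun z hz => (h z hz).trans ?_⟩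
  have haz : a ≤ ‖z‖ := hz.trans (Complex.re_le_norm z)
  have hz0 : 0 < ‖z‖ := ha.trans_le haz
  have h1 : 1 ≤ 1 / a * ‖z‖ := by
    rw [div_mul_eq_mul_div, one_mul, le_div_iff₀ ha]; linarith
  have h2 : 1 + Real.log (1 + ‖z‖) ≤ 2 * (√(1 / a + 1) * √‖z‖) := by
    refine (one_add_log_one_add_le hz0.le).trans ?_
    rw [← Real.sqrt_mul (by positivity)]
    gcongr
    linarith
  have h3 : ‖z‖ ^ (-(1 / 2) : ℝ) = √‖z‖ / ‖z‖ := by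
    rw [Real.sqrt_eq_rpow, ← Real.rpow_sub_one hz0.ne']
    norm_num
  rw [h3, mul_div_assoc', div_le_div_iff_of_pos_right hz0, mul_assoc, mul_assoc 2]
  gcongr

lemma integrable_sq_add_sq_rpow {a : ℝ} (ha : 0 < a) :
    Integrable (fun t : ℝ => (a ^ 2 + t ^ 2) ^ (-(3 / 4) : ℝ)) := by
  have h : Integrable (fun t : ℝ => (1 + ‖t‖ ^ 2) ^ (-(3 / 2 : ℝ) / 2)) :=
    integrable_rpow_neg_one_add_norm_sq (by simp; norm_num)
  have h2 := (h.comp_div ha.ne').const_mul ((a ^ 2) ^ (-(3 / 4) : ℝ))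
  refine h2.congr (Eventually.of_forall fun t => ?_)
  have e : a ^ 2 + t ^ 2 = a ^ 2 * (1 + ‖t / a‖ ^ 2) := by
    rw [Real.norm_eq_abs, sq_abs]; field_simp
  simp only
  rw [e, Real.mul_rpow (by positivity) (by positivity)]
  norm_num

lemma continuous_zhuKernel_line {γ a : ℝ} (hγ : 0 < γ) (ha : 0 < a) :
    Continuous fun t : ℝ => zhuKernel γ (a + t * Complex.I) :=
  (differentiableOn_zhuKernel hγ).continuousOn.comp_continuous (by fun_prop)
    (fun t => by simpa using ha)

lemma norm_line (a t : ℝ) : ‖(a + t * Complex.I : ℂ)‖ = (a ^ 2 + t ^ 2) ^ (1 / 2 : ℝ) := by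
  rw [Complex.norm_add_mul_I, Real.sqrt_eq_rpow]

lemma integrable_zhuKernel_im {γ a : ℝ} (hγ : 0 < γ) (ha : 0 < a) :
    Integrable fun t : ℝ => t / (a ^ 2 + t ^ 2) * (zhuKernel γ (a + t * Complex.I)).im := by
  obtain ⟨C, hC, h⟩ := exists_zhuKernel_rpow_bound hγ ha
  have hpos : ∀ t : ℝ, 0 < a ^ 2 + t ^ 2 := fun t => by positivity
  have hcont := continuous_zhuKernel_line hγ ha
  refine ((integrable_sq_add_sq_rpow ha).const_mul C).mono' ?_ (Eventually.of_forall fun t => ?_)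
  · refine Continuous.aestronglyMeasurable ?_
    exact (continuous_id.div (by fun_prop) fun t => (hpos t).ne').mul
      (Complex.continuous_im.comp hcont)
  · have h1 : |(zhuKernel γ (a + t * Complex.I)).im| ≤ C * (a ^ 2 + t ^ 2) ^ (-(1 / 4) : ℝ) := by
      have e : (zhuKernel γ (a + t * Complex.I)).im
          = (zhuKernel γ (a + t * Complex.I) - 1).im := by simp
      rw [e]
      refine (Complex.abs_im_le_norm _).trans ((h _ (by simp)).trans_eq ?_)
      rw [norm_line, ← Real.rpow_mul (hpos t).le]
      norm_num
    have h2 : |t / (a ^ 2 + t ^ 2)| ≤ (a ^ 2 + t ^ 2) ^ (-(1 / 2) : ℝ) := by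
      rw [abs_div, abs_of_pos (hpos t), div_le_iff₀ (hpos t), ← Real.rpow_add_one (hpos t).ne',
        show (-(1 / 2) + 1 : ℝ) = 1 / 2 by norm_num, ← Real.sqrt_eq_rpow]
      exact Real.abs_le_sqrt (by nlinarith)
    rw [Real.norm_eq_abs, abs_mul]
    calc _ ≤ (a ^ 2 + t ^ 2) ^ (-(1 / 2) : ℝ) * (C * (a ^ 2 + t ^ 2) ^ (-(1 / 4) : ℝ)) := by gcongr
      _ = C * ((a ^ 2 + t ^ 2) ^ (-(1 / 2) : ℝ) * (a ^ 2 + t ^ 2) ^ (-(1 / 4) : ℝ)) := by ring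
      _ = _ := by rw [← Real.rpow_add (hpos t)]; norm_num

lemma hasDerivAt_arctan_sub {a : ℝ} (ha : 0 < a) (t : ℝ) :
    HasDerivAt (fun t => (Real.arctan (t / a) / a - t / (a ^ 2 + t ^ 2)) / 2)
      (t / (a ^ 2 + t ^ 2) * (t / (a ^ 2 + t ^ 2))) t := by
  have hpos : a ^ 2 + t ^ 2 ≠ 0 := by positivity
  have h1 := (((hasDerivAt_id t).div_const a).arctan).div_const a
  have h2 := (hasDerivAt_id t).div (((hasDerivAt_id t).pow 2).const_add (a ^ 2)) (by simpa using hpos)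
  refine ((h1.sub h2).div_const 2).congr_deriv ?_
  simp only [Pi.pow_apply, id_eq]
  have : 1 + (t / a) ^ 2 ≠ 0 := by positivity
  field_simp
  ring

lemma tendsto_arctan_sub {a : ℝ} (ha : 0 < a) :
    Tendsto (fun t => (Real.arctan (t / a) / a - t / (a ^ 2 + t ^ 2)) / 2) atTop
      (𝓝 (π / (4 * a))) := by
  have h1 : Tendsto (fun t : ℝ => Real.arctan (t / a)) atTop (𝓝 (π / 2)) :=
    (tendsto_nhds_of_tendsto_nhdsWithin Real.tendsto_arctan_atTop).comp
      (tendsto_id.atTop_div_const ha)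
  have h2 : Tendsto (fun t : ℝ => t / (a ^ 2 + t ^ 2)) atTop (𝓝 0) := by
    refine squeeze_zero' ?_ ?_ tendsto_inv_atTop_zero
    · filter_upwards [eventually_gt_atTop 0] with t ht
      positivity
    · filter_upwards [eventually_gt_atTop 0] with t ht
      rw [div_le_iff₀ (by positivity)]
      field_simp
      nlinarith
  have h := ((h1.div_const a).sub h2).div_const 2
  convert h using 2
  field_simp
  ring

lemma integrableOn_sq_div {a : ℝ} (ha : 0 < a) :
    IntegrableOn (fun t : ℝ => t / (a ^ 2 + t ^ 2) * (t / (a ^ 2 + t ^ 2))) (Ioi 0) :=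
  integrableOn_Ioi_deriv_of_nonneg (hasDerivAt_arctan_sub ha 0).continuousAt.continuousWithinAt
    (fun t _ => hasDerivAt_arctan_sub ha t) (fun _ _ => mul_self_nonneg _) (tendsto_arctan_sub ha)

lemma integral_sq_div {a : ℝ} (ha : 0 < a) :
    ∫ t in Ioi (0 : ℝ), t / (a ^ 2 + t ^ 2) * (t / (a ^ 2 + t ^ 2)) = π / (4 * a) := by
  rw [integral_Ioi_of_hasDerivAt_of_nonneg
    (hasDerivAt_arctan_sub ha 0).continuousAt.continuousWithinAt
    (fun t _ => hasDerivAt_arctan_sub ha t) (fun _ _ => mul_self_nonneg _) (tendsto_arctan_sub ha)]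
  simp

/-- `zhuKernel γ z - 1 + 1 / z` vanishes at `z = 1 + γ = 2 * a` and decays in the half plane, so
its Poisson-type integral along `re z = a` vanishes. -/
lemma tendsto_integral_zhuKernel {γ a : ℝ} (hγ : 0 < γ) (ha : a = (1 + γ) / 2) :
    Tendsto (fun R : ℝ => ∫ t in -R..R, ((t / (a ^ 2 + t ^ 2) : ℝ) : ℂ) *
      (zhuKernel γ (a + t * Complex.I) - 1 + 1 / (a + t * Complex.I))) atTop (𝓝 0) := by
  have ha0 : 0 < a := by rw [ha]; positivity
  have ha2 : (1 + γ : ℂ) = 2 * a := by rw [ha]; push_cast; ring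
  set H : ℂ → ℂ := fun z => zhuKernel γ z - 1 + 1 / z with hH
  have hne : ∀ z : ℂ, 0 < z.re → z ≠ 0 := fun z hz h => by simp [h] at hz
  have hHd : DifferentiableOn ℂ H {z : ℂ | 0 < z.re} :=
    ((differentiableOn_zhuKernel hγ).sub_const 1).add
      ((differentiableOn_const 1).div differentiableOn_id fun z hz => hne z hz)
  have hH0 : H (2 * a) = 0 := by
    have h1 : (1 + γ : ℂ) ≠ 0 := by exact_mod_cast (by positivity : (1 + γ : ℝ) ≠ 0)
    simp only [hH]
    rw [← ha2, zhuKernel_one_add hγ]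
    field_simp
    ring
  have hdH : DifferentiableOn ℂ (dslope H (2 * a)) {z : ℂ | 0 < z.re} :=
    (Complex.differentiableOn_dslope (isOpen_re_pos.mem_nhds (by simpa using ha0))).2 hHd
  have hGd : DifferentiableOn ℂ (fun z => (z - a) / z * dslope H (2 * a) z) {z : ℂ | 0 < z.re} :=
    ((differentiableOn_id.sub_const (a : ℂ)).div differentiableOn_id fun z hz => hne z hz).mul hdH
  have hdslope : ∀ z : ℂ, (z - 2 * a) * dslope H (2 * a) z = H z := by
    intro z
    have := sub_smul_dslope H (2 * a : ℂ) z
    rwa [hH0, sub_zero] at this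
  obtain ⟨C, hC, hb⟩ := exists_zhuKernel_rpow_bound hγ ha0
  have hHb : ∀ z : ℂ, a ≤ z.re → 1 ≤ ‖z‖ → ‖H z‖ ≤ (C + 1) * ‖z‖ ^ (-(1 / 2) : ℝ) := by
    intro z hz hz1
    have h1 : ‖1 / z‖ ≤ ‖z‖ ^ (-(1 / 2) : ℝ) := by
      rw [norm_div, norm_one, one_div, ← Real.rpow_neg_one]
      exact Real.rpow_le_rpow_of_exponent_le hz1 (by norm_num)
    have := norm_add_le (zhuKernel γ z - 1) (1 / z)
    linarith [hb z hz]
  have hGb : ∀ z : ℂ, a ≤ z.re → 1 + 4 * a ≤ ‖z‖ →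
      ‖(z - a) / z * dslope H (2 * a) z‖ ≤ 4 * (C + 1) * ‖z‖ ^ (-(3 / 2) : ℝ) := by
    intro z hz hzR
    have hz0 : 0 < ‖z‖ := by linarith
    have n2 : ‖(2 * a : ℂ)‖ = 2 * a := by simp [abs_of_pos ha0]
    have n1 : ‖(a : ℂ)‖ = a := by simp [abs_of_pos ha0]
    have h1 : ‖z‖ / 2 ≤ ‖z - 2 * a‖ := by
      have := norm_sub_norm_le z (2 * a : ℂ)
      rw [n2] at this
      linarith
    have h2 : ‖(z - a) / z‖ ≤ 2 := by
      rw [norm_div, div_le_iff₀ hz0]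
      have := norm_sub_le z (a : ℂ)
      rw [n1] at this
      linarith
    have h3 : ‖dslope H (2 * a) z‖ ≤ 2 * ((C + 1) * ‖z‖ ^ (-(3 / 2) : ℝ)) := by
      have h4 := hHb z hz (by linarith)
      rw [← hdslope z, norm_mul] at h4
      have h5 : ‖z‖ ^ (-(1 / 2) : ℝ) = ‖z‖ ^ (-(3 / 2) : ℝ) * ‖z‖ := by
        rw [← Real.rpow_add_one hz0.ne']; norm_num
      rw [h5] at h4
      have h6 : ‖z‖ / 2 * ‖dslope H (2 * a) z‖ ≤ ‖z - 2 * a‖ * ‖dslope H (2 * a) z‖ := by gcongr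
      refine le_of_mul_le_mul_left ?_ hz0
      linarith
    rw [norm_mul]
    calc _ ≤ 2 * (2 * ((C + 1) * ‖z‖ ^ (-(3 / 2) : ℝ))) := by gcongr
      _ = _ := by ring
  have hT := (tendsto_integral_vertical ha0 (by positivity) hGd hGb).const_mul Complex.I
  rw [mul_zero] at hT
  refine hT.congr fun R => ?_
  rw [← intervalIntegral.integral_const_mul]
  congr 1
  funext t
  set z : ℂ := a + t * Complex.I with hz
  have hz0 : z ≠ 0 := hne z (by simpa [hz] using ha0)
  have hz2 : z - 2 * a ≠ 0 := fun h => by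
    have := congrArg Complex.re h
    simp [hz] at this
    linarith
  have hprod : z * (z - 2 * a) = -(a ^ 2 + t ^ 2) := by
    rw [hz]; ring_nf; simp only [Complex.I_sq]; ring
  change _ = _ * H z
  rw [← hdslope z]
  push_cast
  have e : (t : ℂ) / (a ^ 2 + t ^ 2) = -t / (z * (z - 2 * a)) := by rw [hprod, neg_div_neg_eq]
  have e' : z - a = t * Complex.I := by rw [hz]; ring
  rw [e, e']
  generalize dslope H (2 * a) z = D
  field_simp
  rw [Complex.I_sq]
  ring

lemma integral_zhuKernel_im {γ a : ℝ} (hγ : 0 < γ) (ha : a = (1 + γ) / 2) :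
    ∫ t in Ioi (0 : ℝ), t / (a ^ 2 + t ^ 2) * (zhuKernel γ (a + t * Complex.I)).im =
      π / (2 * (1 + γ)) := by
  have ha0 : 0 < a := by rw [ha]; positivity
  set g : ℝ → ℝ := fun t => t / (a ^ 2 + t ^ 2) * (zhuKernel γ (a + t * Complex.I)).im -
    t / (a ^ 2 + t ^ 2) * (t / (a ^ 2 + t ^ 2)) with hg
  have hpos : ∀ t : ℝ, a ^ 2 + t ^ 2 ≠ 0 := fun t => by positivity
  have hne : ∀ t : ℝ, (a + t * Complex.I : ℂ) ≠ 0 := fun t h => by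
    have := congrArg Complex.re h
    simp at this
    linarith
  have hcont := continuous_zhuKernel_line hγ ha0
  have hq : Continuous fun t : ℝ => t / (a ^ 2 + t ^ 2) :=
    continuous_id.div (by fun_prop) hpos
  have hgc : Continuous g := (hq.mul (Complex.continuous_im.comp hcont)).sub (hq.mul hq)
  have heven : ∀ t, g (-t) = g t := by
    intro t
    rcases eq_or_ne t 0 with rfl | ht
    · simp
    · have e : (a + ((-t : ℝ) : ℂ) * Complex.I) = starRingEnd ℂ (a + t * Complex.I) := by
        simp
      simp only [hg]
      rw [e, zhuKernel_conj hγ (by simpa using ha0) (by simpa using ht), Complex.conj_im]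
      rw [neg_sq]
      ring
  have hg1 : IntegrableOn (fun t : ℝ => t / (a ^ 2 + t ^ 2) *
      (zhuKernel γ (a + t * Complex.I)).im) (Ioi 0) :=
    (integrable_zhuKernel_im hγ ha0).integrableOn
  have hgi : IntegrableOn g (Ioi 0) := hg1.sub (integrableOn_sq_div ha0)
  have him : ∀ R : ℝ, (∫ t in -R..R, ((t / (a ^ 2 + t ^ 2) : ℝ) : ℂ) *
      (zhuKernel γ (a + t * Complex.I) - 1 + 1 / (a + t * Complex.I))).im = ∫ t in -R..R, g t := by
    intro R
    have hc : Continuous fun t : ℝ => ((t / (a ^ 2 + t ^ 2) : ℝ) : ℂ) *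
        (zhuKernel γ (a + t * Complex.I) - 1 + 1 / (a + t * Complex.I)) :=
      (Complex.continuous_ofReal.comp hq).mul ((hcont.sub continuous_const).add
        (continuous_const.div (by fun_prop) hne))
    have h := Complex.imCLM.intervalIntegral_comp_comm (hc.intervalIntegrable (μ := volume) (-R) R)
    simp only [Complex.imCLM_apply] at h
    rw [← h]
    congr 1
    funext t
    simp only [hg]
    rw [Complex.im_ofReal_mul, ← mul_sub]
    congr 1
    simp [Complex.normSq_add_mul_I]
    ring
  have hhalf : ∀ R : ℝ, ∫ t in -R..R, g t = 2 * ∫ t in (0 : ℝ)..R, g t := by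
    intro R
    have h1 := intervalIntegral.integral_comp_neg (a := 0) (b := R) g
    simp only [heven, neg_zero] at h1
    rw [← intervalIntegral.integral_add_adjacent_intervals
      (hgc.intervalIntegrable (μ := volume) (-R) 0) (hgc.intervalIntegrable 0 R), ← h1]
    ring
  have hT := (Complex.continuous_im.tendsto _).comp (tendsto_integral_zhuKernel hγ ha)
  simp only [Function.comp_def, him, hhalf, Complex.zero_im] at hT
  have hT2 := (intervalIntegral_tendsto_integral_Ioi 0 hgi tendsto_id).const_mul 2
  have h0 : ∫ t in Ioi (0 : ℝ), g t = 0 := by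
    have := tendsto_nhds_unique hT hT2
    linarith
  rw [hg, integral_sub hg1 (integrableOn_sq_div ha0), integral_sq_div ha0] at h0
  have e : π / (4 * a) = π / (2 * (1 + γ)) := by rw [ha]; congr 1; ring
  linarith

lemma one_sub_exp_neg_le {x : ℝ} (hx : 0 ≤ x) : 1 - Real.exp (-x) ≤ 2 * x / (1 + x) := by
  have h1 := Real.add_one_le_exp (-x)
  have h2 := Real.exp_pos (-x)
  rw [le_div_iff₀ (by linarith)]
  rcases le_total x 1 with h | h <;> nlinarith

lemma one_sub_exp_neg_nonneg {x : ℝ} (hx : 0 ≤ x) : 0 ≤ 1 - Real.exp (-x) := by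
  have := Real.exp_le_one_iff.2 (neg_nonpos.2 hx)
  linarith

lemma integrableOn_one_sub_exp_div :
    IntegrableOn (fun u : ℝ => (1 - Real.exp (-u ^ 2)) / u ^ 2) (Ioi 0) := by
  refine ((integrable_inv_one_add_sq.const_mul 2).integrableOn (s := Ioi 0)).mono' ?_ ?_
  · exact Measurable.aestronglyMeasurable (by fun_prop)
  · refine (ae_restrict_mem measurableSet_Ioi).mono fun u (hu : 0 < u) => ?_
    rw [Real.norm_of_nonneg (div_nonneg (one_sub_exp_neg_nonneg (sq_nonneg u)) (sq_nonneg u)),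
      div_le_iff₀ (by positivity)]
    refine (one_sub_exp_neg_le (sq_nonneg u)).trans_eq ?_
    field_simp

lemma integral_one_sub_exp_div :
    ∫ u in Ioi (0 : ℝ), (1 - Real.exp (-u ^ 2)) / u ^ 2 = √π := by
  have hgauss : IntegrableOn (fun u : ℝ => 2 * Real.exp (-1 * u ^ 2)) (Ioi 0) :=
    ((integrable_exp_neg_mul_sq one_pos).const_mul 2).integrableOn
  have hderiv : ∀ u ∈ Ioi (0 : ℝ), HasDerivAt (fun u : ℝ => -((1 - Real.exp (-u ^ 2)) / u))
      ((1 - Real.exp (-u ^ 2)) / u ^ 2 - 2 * Real.exp (-1 * u ^ 2)) u := by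
    intro u hu
    have hu0 : u ≠ 0 := (mem_Ioi.1 hu).ne'
    have h1 : HasDerivAt (fun u : ℝ => -u ^ 2) (-(2 * u)) u := by
      simpa using (hasDerivAt_pow 2 u).fun_neg
    refine ((h1.exp.const_sub 1).div (hasDerivAt_id u) hu0).neg.congr_deriv ?_
    simp only [id_eq, neg_mul, one_mul]
    field_simp
    ring
  have habs : ∀ u : ℝ, |(-((1 - Real.exp (-u ^ 2)) / u))| ≤ |u| := by
    intro u
    rw [abs_neg, abs_div, abs_of_nonneg (one_sub_exp_neg_nonneg (sq_nonneg u))]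
    rcases eq_or_ne u 0 with rfl | hu
    · simp
    · rw [div_le_iff₀ (abs_pos.2 hu), ← sq, sq_abs]
      linarith [Real.add_one_le_exp (-u ^ 2)]
  have hcont : ContinuousWithinAt (fun u : ℝ => -((1 - Real.exp (-u ^ 2)) / u)) (Ici 0) 0 := by
    refine ContinuousAt.continuousWithinAt ?_
    have h0 : Tendsto (fun u : ℝ => |u|) (𝓝 0) (𝓝 0) := by
      simpa using (continuous_abs (G := ℝ)).tendsto 0
    simpa [ContinuousAt] using squeeze_zero_norm habs h0
  have htop : Tendsto (fun u : ℝ => -((1 - Real.exp (-u ^ 2)) / u)) atTop (𝓝 0) := by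
    refine squeeze_zero_norm' ?_ tendsto_inv_atTop_zero
    filter_upwards [eventually_gt_atTop 0] with u hu
    rw [Real.norm_eq_abs, abs_neg, abs_div, abs_of_pos hu,
      abs_of_nonneg (one_sub_exp_neg_nonneg (sq_nonneg u)), ← one_div]
    have := Real.exp_pos (-u ^ 2)
    gcongr
    linarith
  have h := integral_Ioi_of_hasDerivAt_of_tendsto hcont hderiv
    (integrableOn_one_sub_exp_div.sub hgauss) htop
  rw [integral_sub integrableOn_one_sub_exp_div hgauss, integral_const_mul,
    integral_gaussian_Ioi] at h
  simp only [div_one, div_zero, neg_zero, sub_zero] at h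
  linarith

lemma exists_zhuKernel_im_bound {γ a : ℝ} (hγ : 0 < γ) (ha : 0 < a) :
    ∃ K : ℝ, 0 < K ∧ ∀ q u : ℝ, 1 ≤ Real.log q → 0 < u → 0 < q →
      q * u * |(zhuKernel γ (a + ((q * u : ℝ) : ℂ) * Complex.I)).im| / Real.log q ≤
        K * (1 + u ^ 2) ^ (1 / 4 : ℝ) := by
  obtain ⟨C, hC, h⟩ := exists_zhuKernel_bound hγ ha
  have hla : 0 ≤ Real.log (1 + a) := Real.log_nonneg (by linarith)
  refine ⟨C * (3 + Real.log (1 + a)) * 2, by positivity, fun q u hq hu hq0 => ?_⟩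
  set t := q * u with ht
  set z : ℂ := a + (t : ℂ) * Complex.I with hz
  have ht0 : 0 < t := by positivity
  have hq1 : 1 ≤ q := by linarith [Real.log_le_sub_one_of_pos hq0]
  have htz : t ≤ ‖z‖ := by
    have := Complex.abs_im_le_norm z
    simpa [hz, abs_of_pos ht0] using this
  have hzt : ‖z‖ ≤ a + t := by
    have := norm_add_le (a : ℂ) ((t : ℂ) * Complex.I)
    simpa [abs_of_pos ht0, abs_of_pos ha] using this
  have hz0 : 0 < ‖z‖ := ht0.trans_le htz
  have h1 : t * |(zhuKernel γ z).im| ≤ C * (1 + Real.log (1 + ‖z‖)) := by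
    have e : (zhuKernel γ z).im = (zhuKernel γ z - 1).im := by simp
    have h2 := h z (by simp [hz])
    rw [le_div_iff₀ hz0] at h2
    rw [e]
    refine le_trans ?_ h2
    rw [mul_comm]
    gcongr
    exact Complex.abs_im_le_norm _
  have h3 : Real.log (1 + ‖z‖) ≤ Real.log (1 + a) + Real.log q + Real.log (1 + u) := by
    rw [← Real.log_mul (by positivity) (by positivity), ← Real.log_mul (by positivity)
      (by positivity)]
    refine Real.log_le_log (by positivity) ?_
    have : (1 + a) * q * (1 + u) = q + a * q + t + a * t := by rw [ht]; ring
    rw [this]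
    have : 0 ≤ a * t := by positivity
    nlinarith
  have hs1 : 1 ≤ √(1 + u) := Real.one_le_sqrt.2 (by linarith)
  have h4 := one_add_log_one_add_le hu.le
  have hlu : 0 ≤ Real.log (1 + u) := Real.log_nonneg (by linarith)
  have h5 : √(1 + u) ≤ 2 * (1 + u ^ 2) ^ (1 / 4 : ℝ) := by
    have e1 : (2 : ℝ) * (1 + u ^ 2) ^ (1 / 4 : ℝ) = (16 * (1 + u ^ 2)) ^ (1 / 4 : ℝ) := by
      rw [Real.mul_rpow (by norm_num) (by positivity), show (16 : ℝ) = 2 ^ (4 : ℝ) by norm_num,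
        ← Real.rpow_mul (by norm_num)]
      norm_num
    have e2 : √(1 + u) = ((1 + u) ^ 2) ^ (1 / 4 : ℝ) := by
      rw [Real.sqrt_eq_rpow, ← Real.rpow_natCast, ← Real.rpow_mul (by positivity)]
      norm_num
    rw [e1, e2]
    refine Real.rpow_le_rpow (by positivity) ?_ (by norm_num)
    nlinarith [sq_nonneg (u - 1)]
  rw [div_le_iff₀ (by linarith)]
  refine h1.trans ?_
  have h6 : 1 + Real.log (1 + ‖z‖) ≤ (3 + Real.log (1 + a)) * √(1 + u) * Real.log q := by
    have h7 : 1 + Real.log (1 + a) + Real.log (1 + u) + 1 ≤ (3 + Real.log (1 + a)) * √(1 + u) := by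
      nlinarith
    have h8 : 1 + Real.log (1 + ‖z‖) ≤
        (1 + Real.log (1 + a) + Real.log (1 + u) + 1) * Real.log q := by nlinarith
    refine h8.trans ?_
    gcongr
  calc _ ≤ C * ((3 + Real.log (1 + a)) * (2 * (1 + u ^ 2) ^ (1 / 4 : ℝ)) * Real.log q) := by
        refine mul_le_mul_of_nonneg_left (h6.trans ?_) hC.le
        gcongr
    _ = _ := by ring

lemma tendsto_zhuKernel_scaled {γ a u : ℝ} (hγ : 0 < γ) (hu : 0 < u) :
    Tendsto (fun q : ℝ => q ^ 2 / Real.log q * (q * u / (a ^ 2 + (q * u) ^ 2) *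
      (1 - Real.exp (-((a ^ 2 + (q * u) ^ 2) / q ^ 2))) *
      (zhuKernel γ (a + ((q * u : ℝ) : ℂ) * Complex.I)).im)) atTop
      (𝓝 ((1 - Real.exp (-u ^ 2)) / u ^ 2)) := by
  have h1 := (tendsto_zhuKernel_im (a := a) hγ).comp (tendsto_id.atTop_mul_const hu)
  have h2 : Tendsto (fun q : ℝ => 1 + Real.log u * (Real.log q)⁻¹) atTop (𝓝 1) := by
    simpa using ((tendsto_inv_atTop_zero.comp Real.tendsto_log_atTop).const_mul
      (Real.log u)).const_add 1
  have h3 : Tendsto (fun q : ℝ => a ^ 2 * (q⁻¹) ^ 2 + u ^ 2) atTop (𝓝 (u ^ 2)) := by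
    simpa using ((((tendsto_inv_atTop_zero (𝕜 := ℝ)).pow 2).const_mul (a ^ 2)).add_const (u ^ 2))
  have h4 : Tendsto (fun q : ℝ => (1 - Real.exp (-(a ^ 2 * (q⁻¹) ^ 2 + u ^ 2))) /
      (a ^ 2 * (q⁻¹) ^ 2 + u ^ 2)) atTop (𝓝 ((1 - Real.exp (-u ^ 2)) / u ^ 2)) :=
    (((Real.continuous_exp.tendsto _).comp h3.neg).const_sub 1).div h3 (by positivity)
  have h := (h1.mul h2).mul h4
  rw [one_mul, one_mul] at h
  refine h.congr' ?_
  filter_upwards [eventually_gt_atTop 1, eventually_gt_atTop (1 / u)] with q hq hqu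
  have hq0 : 0 < q := by linarith
  rw [div_lt_iff₀ hu] at hqu
  have hl : Real.log q ≠ 0 := (Real.log_pos hq).ne'
  have hl2 : Real.log (q * u) ≠ 0 := (Real.log_pos hqu).ne'
  have e1 : 1 + Real.log u * (Real.log q)⁻¹ = Real.log (q * u) / Real.log q := by
    rw [Real.log_mul hq0.ne' hu.ne']; field_simp
  have e2 : a ^ 2 * (q⁻¹) ^ 2 + u ^ 2 = (a ^ 2 + (q * u) ^ 2) / q ^ 2 := by
    field_simp
  have hD : a ^ 2 + (q * u) ^ 2 ≠ 0 := by positivity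
  simp only [Function.comp_apply, id_eq]
  rw [e1, e2]
  generalize Real.exp _ = X
  generalize (zhuKernel γ _).im = Y
  generalize Real.log (q * u) = l at *
  field_simp

lemma tendsto_zhu_integral {γ a : ℝ} (hγ : 0 < γ) (ha : 0 < a) :
    Tendsto (fun q : ℝ => q / Real.log q * ∫ t in Ioi (0 : ℝ), t / (a ^ 2 + t ^ 2) *
      (1 - Real.exp (-((a ^ 2 + t ^ 2) / q ^ 2))) * (zhuKernel γ (a + t * Complex.I)).im)
      atTop (𝓝 √π) := by
  obtain ⟨K, hK, hb⟩ := exists_zhuKernel_im_bound hγ ha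
  have hcont := continuous_zhuKernel_line hγ ha
  have hpos : ∀ t : ℝ, a ^ 2 + t ^ 2 ≠ 0 := fun t => by positivity
  have hcg : ∀ q : ℝ, Continuous fun t : ℝ => t / (a ^ 2 + t ^ 2) *
      (1 - Real.exp (-((a ^ 2 + t ^ 2) / q ^ 2))) * (zhuKernel γ (a + t * Complex.I)).im :=
    fun q => ((continuous_id.div (by fun_prop) hpos).mul (by fun_prop)).mul
      (Complex.continuous_im.comp hcont)
  have hdom := tendsto_integral_filter_of_dominated_convergence (μ := volume.restrict (Ioi 0))
    (l := atTop) (F := fun q u : ℝ => q ^ 2 / Real.log q * (q * u / (a ^ 2 + (q * u) ^ 2) *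
      (1 - Real.exp (-((a ^ 2 + (q * u) ^ 2) / q ^ 2))) *
      (zhuKernel γ (a + ((q * u : ℝ) : ℂ) * Complex.I)).im))
    (f := fun u => (1 - Real.exp (-u ^ 2)) / u ^ 2)
    (fun u => 2 * K * (1 ^ 2 + u ^ 2) ^ (-(3 / 4) : ℝ))
    (Eventually.of_forall fun q => (continuous_const.mul ((hcg q).comp
      (continuous_const_mul q))).aestronglyMeasurable)
    ?_ ((integrable_sq_add_sq_rpow one_pos).const_mul (2 * K)).integrableOn
    ((ae_restrict_mem measurableSet_Ioi).mono fun u hu => tendsto_zhuKernel_scaled hγ hu)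
  · rw [integral_one_sub_exp_div] at hdom
    refine hdom.congr' ?_
    filter_upwards [eventually_gt_atTop 0] with q hq
    have h := integral_comp_mul_left_Ioi (fun t : ℝ => t / (a ^ 2 + t ^ 2) *
      (1 - Real.exp (-((a ^ 2 + t ^ 2) / q ^ 2))) * (zhuKernel γ (a + t * Complex.I)).im) 0 hq
    rw [mul_zero, smul_eq_mul] at h
    rw [integral_const_mul, h]
    rw [← mul_assoc]
    congr 1
    field_simp
  · filter_upwards [eventually_gt_atTop 0, Real.tendsto_log_atTop.eventually_ge_atTop 1]
      with q hq hlq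
    refine (ae_restrict_mem measurableSet_Ioi).mono fun u (hu : 0 < u) => ?_
    have h1 := hb q u hlq hu hq
    have hl0 : 0 < Real.log q := by linarith
    set x := (a ^ 2 + (q * u) ^ 2) / q ^ 2 with hx
    have hx0 : 0 < x := by positivity
    have hxu : u ^ 2 ≤ x := by
      rw [hx, le_div_iff₀ (by positivity)]; nlinarith [sq_nonneg a]
    have e : a ^ 2 + (q * u) ^ 2 = q ^ 2 * x := by rw [hx]; field_simp
    have h2 := one_sub_exp_neg_le hx0.le
    have h3 := one_sub_exp_neg_nonneg hx0.le
    rw [e, Real.norm_eq_abs, abs_mul, abs_mul, abs_mul, abs_of_nonneg h3,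
      abs_of_pos (by positivity : 0 < q ^ 2 / Real.log q),
      abs_of_pos (by positivity : 0 < q * u / (q ^ 2 * x))]
    set Y := |(zhuKernel γ (a + ((q * u : ℝ) : ℂ) * Complex.I)).im|
    have hY : 0 ≤ Y := abs_nonneg _
    calc _ ≤ q ^ 2 / Real.log q * (q * u / (q ^ 2 * x) * (2 * x / (1 + x)) * Y) := by gcongr
      _ = 2 / (1 + x) * (q * u * Y / Real.log q) := by field_simp
      _ ≤ 2 / (1 + u ^ 2) * (K * (1 + u ^ 2) ^ (1 / 4 : ℝ)) := by gcongr
      _ = 2 * K * ((1 + u ^ 2) ^ (1 / 4 : ℝ) / (1 + u ^ 2)) := by ring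
      _ = _ := by
        rw [one_pow, ← Real.rpow_sub_one (by positivity)]
        norm_num

lemma tendsto_neg_log_nhdsGT_zero : Tendsto (fun τ : ℝ => -Real.log τ) (𝓝[>] 0) atTop :=
  tendsto_neg_atBot_atTop.comp Real.tendsto_log_nhdsGT_zero

lemma tendsto_sqrt_nhdsGT_zero : Tendsto (fun τ : ℝ => √τ) (𝓝[>] 0) (𝓝 0) := by
  simpa using (Real.continuous_sqrt.tendsto 0).mono_left nhdsWithin_le_nhds

/-- Zhu's boundary deviates from `E` like `E σ / √(2π) * √τ * (-log τ)` close to expiry. -/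
lemma tendsto_zhu {E σ γ a : ℝ} (hσ : 0 < σ) (hγ : 0 < γ) (ha : a = (1 + γ) / 2) :
    Tendsto (fun τ : ℝ => (E - (γ * E / (1 + γ) + (2 * E / π) * ∫ t in Ioi (0 : ℝ),
      t / (a ^ 2 + t ^ 2) * Real.exp (-τ * (σ ^ 2 / 2) * (a ^ 2 + t ^ 2)) *
        (zhuKernel γ (a + t * Complex.I)).im)) / (√τ * -Real.log τ))
      (𝓝[>] 0) (𝓝 (E * σ / √(2 * π))) := by
  have ha0 : 0 < a := by rw [ha]; positivity
  have hπ := Real.pi_pos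
  set q : ℝ → ℝ := fun τ => (√τ)⁻¹ * (√2 / σ) with hq
  have hqlim : Tendsto q (𝓝[>] 0) atTop := by
    refine Tendsto.atTop_mul_const (by positivity) (tendsto_inv_nhdsGT_zero.comp ?_)
    refine tendsto_nhdsWithin_iff.2 ⟨tendsto_sqrt_nhdsGT_zero, ?_⟩
    filter_upwards [self_mem_nhdsWithin] with τ hτ
    exact Real.sqrt_pos.2 hτ
  have h1 := (tendsto_zhu_integral hγ ha0).comp hqlim
  have h2 : Tendsto (fun τ : ℝ => 1 / 2 + Real.log (√2 / σ) * (-Real.log τ)⁻¹) (𝓝[>] 0)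
      (𝓝 (1 / 2)) := by
    have h := ((tendsto_inv_atTop_zero.comp tendsto_neg_log_nhdsGT_zero).const_mul
      (Real.log (√2 / σ))).const_add (1 / 2)
    rwa [mul_zero, add_zero] at h
  have h := ((h1.mul h2).const_mul (2 * E / π)).mul_const (σ / √2)
  have hval : 2 * E / π * (√π * (1 / 2)) * (σ / √2) = E * σ / √(2 * π) := by
    rw [Real.sqrt_mul (by norm_num)]
    have : π = √π * √π := (Real.mul_self_sqrt hπ.le).symm
    have h0 : √π ≠ 0 := by positivity
    rw [div_mul_eq_mul_div, div_mul_div_comm, div_eq_div_iff (by positivity) (by positivity)]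
    linear_combination (-(E * σ * √2)) * this
  rw [hval] at h
  refine h.congr' ?_
  filter_upwards [self_mem_nhdsWithin, Ioo_mem_nhdsGT (zero_lt_one (α := ℝ)),
    hqlim.eventually_gt_atTop 1] with τ (hτ : 0 < τ) hτ1 hq1
  have hsτ : 0 < √τ := Real.sqrt_pos.2 hτ
  have hlτ : 0 < -Real.log τ := by
    have := Real.log_neg hτ hτ1.2
    linarith
  have hlq : 0 < Real.log (q τ) := Real.log_pos hq1
  have e1 : 1 / 2 + Real.log (√2 / σ) * (-Real.log τ)⁻¹ = Real.log (q τ) / (-Real.log τ) := by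
    have : Real.log (q τ) = -(Real.log τ / 2) + Real.log (√2 / σ) := by
      rw [hq, Real.log_mul (by positivity) (by positivity), Real.log_inv, Real.log_sqrt hτ.le]
    have hl0 : Real.log τ ≠ 0 := by linarith
    rw [this]
    field_simp
    ring
  have e2 : ∀ t : ℝ, -((a ^ 2 + t ^ 2) / q τ ^ 2) = -τ * (σ ^ 2 / 2) * (a ^ 2 + t ^ 2) := by
    intro t
    have : q τ ^ 2 = 2 / (τ * σ ^ 2) := by
      rw [hq]
      simp only
      rw [mul_pow, inv_pow, div_pow, Real.sq_sqrt hτ.le, Real.sq_sqrt (by norm_num)]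
      field_simp
    rw [this]
    field_simp
  have hi1 : IntegrableOn (fun t : ℝ => t / (a ^ 2 + t ^ 2) *
      (zhuKernel γ (a + t * Complex.I)).im) (Ioi 0) :=
    (integrable_zhuKernel_im hγ ha0).integrableOn
  have hi2 : IntegrableOn (fun t : ℝ => t / (a ^ 2 + t ^ 2) *
      Real.exp (-τ * (σ ^ 2 / 2) * (a ^ 2 + t ^ 2)) *
      (zhuKernel γ (a + t * Complex.I)).im) (Ioi 0) := by
    refine (hi1.bdd_mul (c := 1) (f := fun t : ℝ => Real.exp (-τ * (σ ^ 2 / 2) * (a ^ 2 + t ^ 2)))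
      (Continuous.aestronglyMeasurable (by fun_prop)) (Eventually.of_forall fun t => ?_)).congr
      (Eventually.of_forall fun t => by simp only; ring)
    rw [Real.norm_of_nonneg (Real.exp_pos _).le, Real.exp_le_one_iff]
    have : 0 ≤ τ * (σ ^ 2 / 2) * (a ^ 2 + t ^ 2) := by positivity
    linarith
  have e3 : (∫ t in Ioi (0 : ℝ), t / (a ^ 2 + t ^ 2) *
      (1 - Real.exp (-((a ^ 2 + t ^ 2) / q τ ^ 2))) * (zhuKernel γ (a + t * Complex.I)).im) =
      π / (2 * (1 + γ)) - ∫ t in Ioi (0 : ℝ), t / (a ^ 2 + t ^ 2) *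
        Real.exp (-τ * (σ ^ 2 / 2) * (a ^ 2 + t ^ 2)) *
        (zhuKernel γ (a + t * Complex.I)).im := by
    rw [← integral_zhuKernel_im hγ ha, ← integral_sub hi1 hi2]
    congr 1
    funext t
    rw [e2]
    ring
  simp only [Function.comp_apply]
  rw [e1, e3]
  generalize (∫ t in Ioi (0 : ℝ), t / (a ^ 2 + t ^ 2) *
    Real.exp (-τ * (σ ^ 2 / 2) * (a ^ 2 + t ^ 2)) * (zhuKernel γ (a + t * Complex.I)).im) = J
  have e4 : q τ / Real.log (q τ) * (π / (2 * (1 + γ)) - J) * (Real.log (q τ) / -Real.log τ) =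
      q τ * (π / (2 * (1 + γ)) - J) / -Real.log τ := by
    generalize -Real.log τ = l at *
    field_simp
  have e5 : q τ * (σ / √2) = (√τ)⁻¹ := by
    simp only [hq]
    field_simp
  have e6 : E - (γ * E / (1 + γ) + 2 * E / π * J) = 2 * E / π * (π / (2 * (1 + γ)) - J) := by
    field_simp
    ring
  rw [e4, e6]
  calc _ = 2 * E / π * ((q τ * (σ / √2)) * (π / (2 * (1 + γ)) - J) / -Real.log τ) := by ring
    _ = _ := by
      rw [e5]
      generalize -Real.log τ = l at *
      field_simp

/-- The Stamicar–Ševčovič–Chadam boundary deviates from `E` like `E σ * √τ * √(-log τ)` close to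
expiry. -/
lemma tendsto_ssc {E r σ : ℝ} (hr : 0 < r) (hσ : 0 < σ) :
    Tendsto (fun τ : ℝ => (E - E * Real.exp (-(r - σ ^ 2 / 2) * τ - σ * √(2 * τ) *
      √(-Real.log ((2 * r / σ) * √(2 * π * τ) * Real.exp (r * τ))))) / (√τ * √(-Real.log τ)))
      (𝓝[>] 0) (𝓝 (E * σ)) := by
  have hπ := Real.pi_pos
  set A : ℝ → ℝ := fun τ => (2 * r / σ) * √(2 * π * τ) * Real.exp (r * τ) with hA
  set y : ℝ → ℝ := fun τ => (r - σ ^ 2 / 2) * τ + σ * √(2 * τ) * √(-Real.log (A τ)) with hy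
  have hlog := tendsto_neg_log_nhdsGT_zero
  have hsqlog : Tendsto (fun τ : ℝ => √(-Real.log τ)) (𝓝[>] 0) atTop :=
    Real.tendsto_sqrt_atTop.comp hlog
  have hid : Tendsto (fun τ : ℝ => τ) (𝓝[>] 0) (𝓝 0) := nhdsWithin_le_nhds
  have hratio : Tendsto (fun τ : ℝ => -Real.log (A τ) / -Real.log τ) (𝓝[>] 0) (𝓝 (1 / 2)) := by
    have h := ((((hid.const_mul r).const_add (Real.log (2 * r / σ * √(2 * π)))).mul
      (tendsto_inv_atTop_zero.comp hlog)).const_sub (1 / 2))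
    rw [mul_zero, sub_zero] at h
    refine h.congr' ?_
    filter_upwards [self_mem_nhdsWithin, Ioo_mem_nhdsGT (zero_lt_one (α := ℝ))]
      with τ (hτ : 0 < τ) hτ1
    have hl : Real.log τ ≠ 0 := (Real.log_neg hτ hτ1.2).ne
    have e : Real.log (A τ) = Real.log (2 * r / σ * √(2 * π)) + Real.log τ / 2 + r * τ := by
      simp only [hA]
      rw [Real.sqrt_mul (by positivity), ← mul_assoc, Real.log_mul (by positivity) (by positivity),
        Real.log_mul (by positivity) (by positivity), Real.log_exp, Real.log_sqrt hτ.le]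
    rw [e, Function.comp_apply]
    field_simp
    ring
  have hylim : Tendsto (fun τ => y τ / (√τ * √(-Real.log τ))) (𝓝[>] 0) (𝓝 σ) := by
    have h1 := ((tendsto_sqrt_nhdsGT_zero.mul
      (tendsto_inv_atTop_zero.comp hsqlog)).const_mul (r - σ ^ 2 / 2)).add
      (((Real.continuous_sqrt.tendsto _).comp hratio).const_mul (σ * √2))
    have hval : (r - σ ^ 2 / 2) * (0 * 0) + σ * √2 * √(1 / 2) = σ := by
      rw [mul_assoc σ, ← Real.sqrt_mul (by norm_num)]
      norm_num
    rw [hval] at h1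
    refine h1.congr' ?_
    filter_upwards [self_mem_nhdsWithin, Ioo_mem_nhdsGT (zero_lt_one (α := ℝ))]
      with τ (hτ : 0 < τ) hτ1
    have hl : 0 < -Real.log τ := by
      have := Real.log_neg hτ hτ1.2
      linarith
    have hsl : 0 < √(-Real.log τ) := Real.sqrt_pos.2 hl
    have hsτ : 0 < √τ := Real.sqrt_pos.2 hτ
    simp only [Function.comp_apply, hy]
    rw [Real.sqrt_div' _ hl.le, Real.sqrt_mul (by norm_num : (0 : ℝ) ≤ 2)]
    have hs := Real.mul_self_sqrt hτ.le
    generalize √(-Real.log (A τ)) = B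
    generalize √(-Real.log τ) = l at *
    generalize √τ = s at *
    field_simp
    linear_combination (r * 2 - σ ^ 2) * hs
  have hτlog : Tendsto (fun τ : ℝ => √τ * √(-Real.log τ)) (𝓝[>] 0) (𝓝 0) := by
    have h0 := (Real.continuous_mul_log.tendsto 0).mono_left (nhdsWithin_le_nhds (s := Ioi 0))
    have h := (Real.continuous_sqrt.tendsto _).comp h0.neg
    rw [zero_mul, neg_zero, Real.sqrt_zero] at h
    refine h.congr' ?_
    filter_upwards [self_mem_nhdsWithin] with τ (hτ : 0 < τ)
    rw [Function.comp_apply, ← mul_neg, Real.sqrt_mul hτ.le]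
  have hy0 : Tendsto (fun τ => -y τ) (𝓝[>] 0) (𝓝 0) := by
    have h := (hylim.mul hτlog).neg
    rw [mul_zero, neg_zero] at h
    refine h.congr' ?_
    filter_upwards [self_mem_nhdsWithin, hsqlog.eventually_gt_atTop 0] with τ (hτ : 0 < τ) hl
    have hsτ : 0 < √τ := Real.sqrt_pos.2 hτ
    rw [div_mul_cancel₀ _ (by positivity)]
  have hd : Tendsto (fun τ => dslope Real.exp 0 (-y τ)) (𝓝[>] 0) (𝓝 1) := by
    have hc : ContinuousAt (dslope Real.exp 0) 0 :=
      continuousAt_dslope_same.2 Real.differentiable_exp.differentiableAt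
    simpa [ContinuousAt, dslope_same, Real.deriv_exp, Function.comp_def] using hc.tendsto.comp hy0
  have h := (hylim.mul hd).const_mul E
  rw [mul_one] at h
  refine h.congr fun τ => ?_
  have e := sub_smul_dslope Real.exp 0 (-y τ)
  rw [sub_zero, Real.exp_zero, smul_eq_mul] at e
  have e2 : -(r - σ ^ 2 / 2) * τ - σ * √(2 * τ) * √(-Real.log (A τ)) = -y τ := by
    simp only [hy]; ring
  rw [e2]
  have e3 : E - E * Real.exp (-y τ) = E * (y τ * dslope Real.exp 0 (-y τ)) := by
    linear_combination E * e
  rw [e3]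
  ring

/-- Comparison of the SSC and Zhu approximations close to expiry:
`lim_{τ→0⁺} [(E - ϱ^{SSC}(τ))/(E - ϱ^{Zhu}(τ))]·√(-ln τ) = √(2π)`; in particular
`lim_{τ→0⁺} (E - ϱ^{SSC}(τ))/(E - ϱ^{Zhu}(τ)) = 0`, so close to expiry Zhu's formula
undershoots the early exercise boundary relative to `ϱ^{SSC}`. -/
theorem stmt_13 (E r σ : ℝ) (hE : 0 < E) (hr : 0 < r) (hσ : 0 < σ)
    (γ a b : ℝ) (hγ : γ = 2 * r / σ ^ 2) (ha : a = (1 + γ) / 2) (hb : b = (1 - γ) / 2)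
    (f₁ f₂ : ℝ → ℝ)
    (hf₁ : ∀ ζ : ℝ, 0 < ζ →
      f₁ ζ = (b * Real.log ((1 / γ) * Real.sqrt (a ^ 2 + ζ ^ 2))
        + ζ * Real.arctan (ζ / a)) / (b ^ 2 + ζ ^ 2))
    (hf₂ : ∀ ζ : ℝ, 0 < ζ →
      f₂ ζ = (ζ * Real.log ((1 / γ) * Real.sqrt (a ^ 2 + ζ ^ 2))
        - b * Real.arctan (ζ / a)) / (b ^ 2 + ζ ^ 2))
    (ϱSSC ϱZhu : ℝ → ℝ)
    (hSSC : ∀ τ : ℝ, 0 < τ →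
      (2 * r / σ) * Real.sqrt (2 * Real.pi * τ) * Real.exp (r * τ) < 1 →
      ϱSSC τ = E * Real.exp (-(r - σ ^ 2 / 2) * τ - σ * Real.sqrt (2 * τ) *
        Real.sqrt (-Real.log ((2 * r / σ) * Real.sqrt (2 * Real.pi * τ)
          * Real.exp (r * τ)))))
    (hZhu : ∀ τ : ℝ, 0 < τ →
      ϱZhu τ = γ * E / (1 + γ) + (2 * E / Real.pi) *
        ∫ ζ in Set.Ioi (0 : ℝ),
          (ζ * Real.exp (-τ * (σ ^ 2 / 2) * (a ^ 2 + ζ ^ 2)) / (a ^ 2 + ζ ^ 2))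
            * Real.exp (-(f₁ ζ)) * Real.sin (f₂ ζ)) :
    Filter.Tendsto
      (fun τ : ℝ => (E - ϱSSC τ) / (E - ϱZhu τ) * Real.sqrt (-Real.log τ))
      (nhdsWithin 0 (Set.Ioi 0)) (nhds (Real.sqrt (2 * Real.pi))) ∧
    Filter.Tendsto (fun τ : ℝ => (E - ϱSSC τ) / (E - ϱZhu τ))
      (nhdsWithin 0 (Set.Ioi 0)) (nhds 0) := by
  have hγ0 : 0 < γ := by rw [hγ]; positivity
  have ha0 : 0 < a := by rw [ha]; positivity
  have hba : b = a - γ := by rw [ha, hb]; ring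
  have hπ := Real.pi_pos
  have hZ : Tendsto (fun τ : ℝ => (E - ϱZhu τ) / (√τ * -Real.log τ)) (𝓝[>] 0)
      (𝓝 (E * σ / √(2 * π))) := by
    refine (tendsto_zhu (E := E) hσ hγ0 ha).congr' ?_
    filter_upwards [self_mem_nhdsWithin] with τ hτ
    have e : ∫ ζ in Set.Ioi (0 : ℝ),
        (ζ * Real.exp (-τ * (σ ^ 2 / 2) * (a ^ 2 + ζ ^ 2)) / (a ^ 2 + ζ ^ 2))
          * Real.exp (-(f₁ ζ)) * Real.sin (f₂ ζ) =
        ∫ t in Ioi (0 : ℝ), t / (a ^ 2 + t ^ 2) *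
          Real.exp (-τ * (σ ^ 2 / 2) * (a ^ 2 + t ^ 2)) *
          (zhuKernel γ (a + t * Complex.I)).im := by
      refine setIntegral_congr_fun measurableSet_Ioi fun ζ hζ => ?_
      rw [zhuKernel_im hγ0 ha0 hba hζ, hf₁ ζ hζ, hf₂ ζ hζ]
      ring
    rw [hZhu τ hτ, e]
  have hS : Tendsto (fun τ : ℝ => (E - ϱSSC τ) / (√τ * √(-Real.log τ))) (𝓝[>] 0)
      (𝓝 (E * σ)) := by
    refine (tendsto_ssc (E := E) hr hσ).congr' ?_
    have hA : Tendsto (fun τ : ℝ => (2 * r / σ) * √(2 * π * τ) * Real.exp (r * τ)) (𝓝[>] 0)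
        (𝓝 0) := by
      have hc : Continuous fun τ : ℝ => (2 * r / σ) * √(2 * π * τ) * Real.exp (r * τ) := by
        fun_prop
      simpa using (hc.tendsto 0).mono_left nhdsWithin_le_nhds
    filter_upwards [self_mem_nhdsWithin, hA.eventually_lt_const one_pos] with τ hτ hτ1
    rw [hSSC τ hτ hτ1]
  have hmain : Tendsto (fun τ : ℝ => (E - ϱSSC τ) / (E - ϱZhu τ) * √(-Real.log τ)) (𝓝[>] 0)
      (𝓝 √(2 * π)) := by
    have h := hS.div hZ (by positivity)
    have hval : E * σ / (E * σ / √(2 * π)) = √(2 * π) := by field_simp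
    rw [hval] at h
    refine h.congr' ?_
    filter_upwards [self_mem_nhdsWithin, tendsto_neg_log_nhdsGT_zero.eventually_gt_atTop 0]
      with τ (hτ : 0 < τ) hl
    have hsτ : 0 < √τ := Real.sqrt_pos.2 hτ
    have hsl : 0 < √(-Real.log τ) := Real.sqrt_pos.2 hl
    rw [Pi.div_apply]
    nth_rewrite 2 [← Real.mul_self_sqrt hl.le]
    generalize √(-Real.log τ) = l at *
    rcases eq_or_ne (E - ϱZhu τ) 0 with h0 | h0
    · simp [h0]
    · field_simp
  refine ⟨hmain, ?_⟩
  have hsq : Tendsto (fun τ : ℝ => √(-Real.log τ)) (𝓝[>] 0) atTop :=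
    Real.tendsto_sqrt_atTop.comp tendsto_neg_log_nhdsGT_zero
  have h := hmain.mul (tendsto_inv_atTop_zero.comp hsq)
  rw [mul_zero] at h
  refine h.congr' ?_
  filter_upwards [hsq.eventually_gt_atTop 0] with τ hl
  rw [Function.comp_apply, mul_assoc, mul_inv_cancel₀ hl.ne', mul_one]
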